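/- Let A=(a_{ij}) be an n×n generalized Cartan matrix with n ≥ 2 such that a_{ij}a_{ji}=2 for all i≠j (equivalently, every off-diagonal Coxeter matrix entry equals 4). Then in ℤ⟦t⟧: ( ((n−1)(n−2)/2)·t⁴ − (n−2)·(t³+t²+t) + 1 ) · P(A) = (1+t)(1+t+t²+t³). -/

import Mathlib

open PowerSeries

/-- The Poincaré series of (the Coxeter group of) a Coxeter matrix: the generating
function of the number of elements of each length in its Coxeter group. -/
noncomputable def coxPoincare {B : Type*} (M : CoxeterMatrix B) : PowerSeries ℤ :=
  PowerSeries.mk fun k =>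
    (Nat.card {w : M.Group // M.toCoxeterSystem.length w = k} : ℤ)

/-- `A` is a generalized Cartan matrix. -/
structure IsGCM {n : ℕ} (A : Matrix (Fin n) (Fin n) ℤ) : Prop where
  diag : ∀ i, A i i = 2
  nonpos : ∀ i j, i ≠ j → A i j ≤ 0
  zero_symm : ∀ i j, A i j = 0 → A j i = 0

/-- The Coxeter matrix entry associated to the product `aᵢⱼ·aⱼᵢ`:
it is `2, 3, 4, 6, ∞` according as the product is `0, 1, 2, 3, ≥ 4`
(`0` encodes `∞`, as in Mathlib's convention for `CoxeterMatrix`). -/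
def gcmEntry (p : ℤ) : ℕ :=
  if p = 0 then 2 else if p = 1 then 3 else if p = 2 then 4 else if p = 3 then 6 else 0

/-- The Coxeter matrix of a generalized Cartan matrix. -/
def gcmCoxeter {n : ℕ} (A : Matrix (Fin n) (Fin n) ℤ) : CoxeterMatrix (Fin n) where
  M := Matrix.of fun i j => if i = j then 1 else gcmEntry (A i j * A j i)
  isSymm := by
    ext i j
    simp only [Matrix.transpose_apply, Matrix.of_apply]
    rcases eq_or_ne i j with h | h
    · simp [h]
    · rw [if_neg h.symm, if_neg h, mul_comm]
  diagonal i := by simp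
  off_diagonal i j h := by
    rw [Matrix.of_apply, if_neg h]
    unfold gcmEntry
    split_ifs <;> omega

open Classical in
/-- The root datum attached to a Coxeter system: `R w i` is the image of the `i`-th simple root. -/
structure RootData {n : ℕ} (A : Matrix (Fin n) (Fin n) ℤ) {W : Type} [Group W]
    {M : CoxeterMatrix (Fin n)} (cs : CoxeterSystem M W) (R : W → Fin n → (Fin n → ℤ)) : Prop where
  nonpos : ∀ i j, i ≠ j → A i j ≤ 0
  diag : ∀ i, A i i = 2
  prod : ∀ i j, i ≠ j → A i j * A j i = 2
  four : ∀ i j, i ≠ j → M i j = 4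
  one : ∀ i, R 1 i = Pi.single i 1
  step : ∀ w i j, R (w * cs.simple i) j = R w j - A i j • R w i
  ne : ∀ w i, R w i ≠ 0

/-- The simple reflection acting on the root lattice. -/
def srefl {n : ℕ} (A : Matrix (Fin n) (Fin n) ℤ) (i : Fin n) : Module.End ℤ (Fin n → ℤ) where
  toFun v := v - (∑ j, A i j * v j) • Pi.single i 1
  map_add' v w := by
    ext k
    simp [mul_add, Finset.sum_add_distrib]
    ring
  map_smul' c v := by
    ext k
    have : ∑ j, A i j * (c * v j) = c * ∑ j, A i j * v j := by
      rw [Finset.mul_sum]; exact Finset.sum_congr rfl fun j _ => by ring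
    simp [this]
    ring

lemma srefl_apply {n : ℕ} (A : Matrix (Fin n) (Fin n) ℤ) (i : Fin n) (v : Fin n → ℤ) :
    srefl A i v = v - (∑ j, A i j * v j) • Pi.single i 1 := rfl

lemma srefl_fst {n : ℕ} (A : Matrix (Fin n) (Fin n) ℤ) (hd : ∀ i, A i i = 2) (i j : Fin n)
    (v : Fin n → ℤ) (x y : ℤ) :
    srefl A i (v - x • Pi.single i 1 - y • Pi.single j 1)
      = v - ((∑ k, A i k * v k) - x - y * A i j) • Pi.single i 1 - y • Pi.single j 1 := by
  rw [srefl_apply]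
  have : ∑ k, A i k * (v - x • Pi.single i (1:ℤ) - y • Pi.single j (1:ℤ) : Fin n → ℤ) k
      = (∑ k, A i k * v k) - 2 * x - y * A i j := by
    simp [mul_sub, Finset.sum_sub_distrib, Pi.single_apply, hd]
    ring
  rw [this]
  module

lemma srefl_snd {n : ℕ} (A : Matrix (Fin n) (Fin n) ℤ) (hd : ∀ i, A i i = 2) (i j : Fin n)
    (v : Fin n → ℤ) (x y : ℤ) :
    srefl A j (v - x • Pi.single i 1 - y • Pi.single j 1)
      = v - x • Pi.single i 1 - ((∑ k, A j k * v k) - y - x * A j i) • Pi.single j 1 := by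
  have := srefl_fst A hd j i v y x
  rw [sub_right_comm, this, sub_right_comm]

lemma srefl_liftable {n : ℕ} (A : Matrix (Fin n) (Fin n) ℤ) (hd : ∀ i, A i i = 2)
    (hp : ∀ i j, i ≠ j → A i j * A j i = 2) (M : CoxeterMatrix (Fin n))
    (hM : ∀ i j, i ≠ j → M i j = 4) : M.IsLiftable (srefl A) := by
  intro i j
  by_cases hij : i = j
  · subst hij
    rw [M.diagonal, pow_one]
    refine LinearMap.ext fun v => ?_
    have h0 : v = v - (0:ℤ) • Pi.single i (1:ℤ) - (0:ℤ) • Pi.single i (1:ℤ) := by simp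
    rw [Module.End.mul_apply, Module.End.one_apply]
    conv_lhs => rw [h0, srefl_fst A hd, srefl_fst A hd]
    simp
  · rw [hM i j hij]
    refine LinearMap.ext fun v => ?_
    have h0 : v = v - (0:ℤ) • Pi.single i (1:ℤ) - (0:ℤ) • Pi.single j (1:ℤ) := by simp
    simp only [pow_succ, pow_zero, one_mul, Module.End.mul_apply, Module.End.one_apply]
    conv_lhs => rw [h0]
    rw [srefl_snd A hd i j, srefl_fst A hd i j, srefl_snd A hd i j, srefl_fst A hd i j,
      srefl_snd A hd i j, srefl_fst A hd i j, srefl_snd A hd i j, srefl_fst A hd i j]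
    conv_rhs => rw [h0]
    have hab := hp i j hij
    generalize (∑ k, A i k * v k) = p
    generalize (∑ k, A j k * v k) = q
    generalize A i j = a at *
    generalize A j i = b at *
    congr 3
    · grind
    · grind

section
variable {n : ℕ} {A : Matrix (Fin n) (Fin n) ℤ} {W : Type} [Group W]
    {M : CoxeterMatrix (Fin n)} {cs : CoxeterSystem M W} {R : W → Fin n → (Fin n → ℤ)}

namespace RootData

lemma step_self (H : RootData A cs R) (w : W) (i : Fin n) :
    R (w * cs.simple i) i = - R w i := by
  rw [H.step, H.diag]; module

lemma braid (H : RootData A cs R) {i j : Fin n} (hij : i ≠ j) :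
    cs.simple i * cs.simple j * cs.simple i * cs.simple j
      = cs.simple j * cs.simple i * cs.simple j * cs.simple i := by
  have h := cs.simple_mul_simple_pow i j
  rw [H.four i j hij] at h
  have h2 : (cs.simple i * cs.simple j * cs.simple i * cs.simple j) *
    (cs.simple i * cs.simple j * cs.simple i * cs.simple j) = 1 := by
    rw [← h]; simp only [pow_succ, pow_zero, one_mul, mul_assoc]
  have h3 := eq_inv_of_mul_eq_one_left h2
  rw [h3]
  simp [mul_assoc]

lemma st1 (H : RootData A cs R) (w : W) (i j : Fin n) :
    R (w * cs.simple i) j = R w j - A i j • R w i := H.step w i j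

lemma st2 (H : RootData A cs R) (w : W) {i j : Fin n} (hij : i ≠ j) :
    R (w * cs.simple i * cs.simple j) i = R w i - A j i • R w j := by
  rw [H.step, H.step_self, H.step]
  have := H.prod i j hij
  ext k
  simp
  linear_combination R w i k * this

lemma st3 (H : RootData A cs R) (w : W) {i j : Fin n} (hij : i ≠ j) :
    R (w * cs.simple i * cs.simple j * cs.simple i) j = R w j := by
  rw [H.step, H.st2 w hij, H.step_self, H.step]
  have := H.prod i j hij
  ext k
  simp
  linear_combination R w j k * this

lemma st4 (H : RootData A cs R) (w : W) {i j : Fin n} (hij : i ≠ j) :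
    R (w * cs.simple i * cs.simple j * cs.simple i * cs.simple j) j = - R w j := by
  rw [H.step_self, H.st3 w hij]

lemma st4' (H : RootData A cs R) (w : W) {i j : Fin n} (hij : i ≠ j) :
    R (w * cs.simple i * cs.simple j * cs.simple i * cs.simple j) i = - R w i := by
  have := H.braid hij
  simp only [mul_assoc] at this ⊢
  rw [this]
  simpa only [mul_assoc] using H.st4 w hij.symm

lemma add_nonneg' (H : RootData A cs R) {i j : Fin n} (hij : i ≠ j) {x y : Fin n → ℤ}
    (hx : 0 ≤ x) (hy : 0 ≤ y) : 0 ≤ x - A i j • y := by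
  intro k
  have h1 := hx k
  have h2 := hy k
  have := H.nonpos i j hij
  simp at *
  nlinarith

lemma pos (H : RootData A cs R) : ∀ (N : ℕ) (w : W), cs.length w = N → ∀ i,
    ¬ cs.IsRightDescent w i → 0 ≤ R w i := by
  intro N
  induction N using Nat.strong_induction_on with
  | _ N ih =>
  intro w hw s hs
  by_cases hw1 : w = 1
  · subst hw1
    rw [H.one]
    simp
  obtain ⟨t, ht⟩ := cs.exists_rightDescent_of_ne_one hw1
  have hst : s ≠ t := by rintro rfl; exact hs ht
  obtain ⟨w1, rfl⟩ : ∃ w1, w = w1 * cs.simple t := ⟨w * cs.simple t, by simp⟩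
  have hl1 := cs.isRightDescent_iff.1 ht
  simp only [cs.simple_mul_simple_cancel_right] at hl1
  have n1 : ¬ cs.IsRightDescent w1 t := by rw [cs.not_isRightDescent_iff]; omega
  have p1 := ih _ (by omega) w1 rfl t n1
  by_cases d1 : cs.IsRightDescent w1 s
  swap
  · rw [H.step]
    exact H.add_nonneg' hst.symm (ih _ (by omega) w1 rfl s d1) p1
  obtain ⟨w2, rfl⟩ : ∃ w2, w1 = w2 * cs.simple s := ⟨w1 * cs.simple s, by simp⟩
  have hl2 := cs.isRightDescent_iff.1 d1
  simp only [cs.simple_mul_simple_cancel_right] at hl2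
  have n2 : ¬ cs.IsRightDescent w2 s := by rw [cs.not_isRightDescent_iff]; omega
  have p2 := ih _ (by omega) w2 rfl s n2
  by_cases d2 : cs.IsRightDescent w2 t
  swap
  · rw [H.st2 _ hst]
    exact H.add_nonneg' hst.symm p2 (ih _ (by omega) w2 rfl t d2)
  obtain ⟨w3, rfl⟩ : ∃ w3, w2 = w3 * cs.simple t := ⟨w2 * cs.simple t, by simp⟩
  have hl3 := cs.isRightDescent_iff.1 d2
  simp only [cs.simple_mul_simple_cancel_right] at hl3
  by_cases d3 : cs.IsRightDescent w3 s
  swap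
  · rw [H.st3 _ hst.symm]
    exact ih _ (by omega) w3 rfl s d3
  obtain ⟨w4, rfl⟩ : ∃ w4, w3 = w4 * cs.simple s := ⟨w3 * cs.simple s, by simp⟩
  have hl4 := cs.isRightDescent_iff.1 d3
  simp only [cs.simple_mul_simple_cancel_right] at hl4
  exfalso
  apply hs
  unfold CoxeterSystem.IsRightDescent
  have e : w4 * cs.simple s * cs.simple t * cs.simple s * cs.simple t * cs.simple s
      = w4 * cs.simple t * cs.simple s * cs.simple t := by
    have := H.braid hst
    calc _ = w4 * (cs.simple s * cs.simple t * cs.simple s * cs.simple t) * cs.simple s := by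
          simp only [mul_assoc]
      _ = _ := by rw [this]; simp [mul_assoc]
  rw [e]
  have := cs.length_mul_simple w4 t
  have := cs.length_mul_simple (w4 * cs.simple t) s
  have := cs.length_mul_simple (w4 * cs.simple t * cs.simple s) t
  omega

lemma pos' (H : RootData A cs R) {w : W} {i : Fin n} (h : ¬ cs.IsRightDescent w i) :
    0 ≤ R w i := H.pos _ w rfl i h

lemma neg' (H : RootData A cs R) {w : W} {i : Fin n} (h : cs.IsRightDescent w i) :
    R w i ≤ 0 := by
  have := H.pos' (cs.isRightDescent_iff_not_isRightDescent_mul.1 h)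
  rw [H.step_self] at this
  simpa using this

lemma nd_of_pos (H : RootData A cs R) {w : W} {i : Fin n} (h : 0 ≤ R w i) :
    ¬ cs.IsRightDescent w i := fun hd => H.ne w i (le_antisymm (H.neg' hd) h)

lemma d_of_neg (H : RootData A cs R) {w : W} {i : Fin n} (h : R w i ≤ 0) :
    cs.IsRightDescent w i := by
  by_contra hd
  exact H.ne w i (le_antisymm h (H.pos' hd))

lemma len4 (H : RootData A cs R) {w : W} {i j : Fin n} (hij : i ≠ j)
    (hi : ¬ cs.IsRightDescent w i) (hj : ¬ cs.IsRightDescent w j) :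
    cs.length (w * cs.simple i * cs.simple j * cs.simple i * cs.simple j) = cs.length w + 4 := by
  have pi := H.pos' hi
  have pj := H.pos' hj
  have h1 := cs.not_isRightDescent_iff.1 hi
  have h2 := cs.not_isRightDescent_iff.1 (H.nd_of_pos (w := w * cs.simple i) (i := j)
    (by rw [H.st1]; exact H.add_nonneg' hij pj pi))
  have h3 := cs.not_isRightDescent_iff.1 (H.nd_of_pos (w := w * cs.simple i * cs.simple j) (i := i)
    (by rw [H.st2 _ hij]; exact H.add_nonneg' hij.symm pi pj))
  have h4 := cs.not_isRightDescent_iff.1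
    (H.nd_of_pos (w := w * cs.simple i * cs.simple j * cs.simple i) (i := j)
    (by rw [H.st3 _ hij]; exact pj))
  omega

lemma delta (H : RootData A cs R) {a b c : Fin n} (hab : a ≠ b) (hac : a ≠ c) (hbc : b ≠ c) :
    ∀ (N : ℕ) (w : W), cs.length w = N →
      Pi.single a 1 + Pi.single b 1 + Pi.single c 1 ≤ R w a + R w b + R w c := by
  intro N
  induction N with
  | zero =>
    intro w hw
    rw [cs.length_eq_zero_iff] at hw
    subst hw
    simp [H.one]
  | succ N ih =>
    intro w hw
    have hw1 : w ≠ 1 := by rintro rfl; simp at hw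
    obtain ⟨t, ht⟩ := cs.exists_rightDescent_of_ne_one hw1
    obtain ⟨w1, rfl⟩ : ∃ w1, w = w1 * cs.simple t := ⟨w * cs.simple t, by simp⟩
    have hl1 := cs.isRightDescent_iff.1 ht
    simp only [cs.simple_mul_simple_cancel_right] at hl1
    have n1 : ¬ cs.IsRightDescent w1 t := by rw [cs.not_isRightDescent_iff]; omega
    have p1 := H.pos' n1
    refine (ih w1 (by omega)).trans ?_
    rw [H.step, H.step, H.step]
    have hneg : ∀ i j, i ≠ j → A i j ≤ -1 := by
      intro i j hij
      have h1 := H.nonpos i j hij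
      have h2 := H.prod i j hij
      have : A i j ≠ 0 := by intro h0; simp [h0] at h2
      omega
    have hs : A t a + A t b + A t c ≤ 0 := by
      by_cases h1 : t = a
      · subst h1
        have := hneg _ _ hab
        have := hneg _ _ hac
        have := H.diag t
        omega
      by_cases h2 : t = b
      · subst h2
        have := hneg _ _ hab.symm
        have := hneg _ _ hbc
        have := H.diag t
        omega
      by_cases h3 : t = c
      · subst h3
        have := hneg _ _ hac.symm
        have := hneg _ _ hbc.symm
        have := H.diag t
        omega
      have := hneg _ _ h1
      have := hneg _ _ h2
      have := hneg _ _ h3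
      omega
    intro k
    have := p1 k
    simp at *
    nlinarith

lemma no_three (H : RootData A cs R) {a b c : Fin n} (hab : a ≠ b) (hac : a ≠ c) (hbc : b ≠ c)
    (w : W) (ha : cs.IsRightDescent w a) (hb : cs.IsRightDescent w b)
    (hc : cs.IsRightDescent w c) : False := by
  have h := H.delta hab hac hbc _ w rfl a
  have h1 := H.neg' ha a
  have h2 := H.neg' hb a
  have h3 := H.neg' hc a
  simp [hab, hac] at *
  omega

end RootData

lemma finite_len (cs : CoxeterSystem M W) (k : ℕ) : {w : W | cs.length w = k}.Finite := by
  refine ((List.finite_length_eq (Fin n) k).image cs.wordProd).subset ?_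
  intro w hw
  obtain ⟨ω, h1, h2⟩ := cs.exists_isReduced w
  refine ⟨ω, ?_, h2.symm⟩
  rw [CoxeterSystem.IsReduced, ← h2] at h1
  simp at hw ⊢
  omega

/-- Elements of length `k`. -/
noncomputable def sph (cs : CoxeterSystem M W) (k : ℕ) : Finset W := (finite_len cs k).toFinset

lemma mem_sph (cs : CoxeterSystem M W) (k : ℕ) (w : W) : w ∈ sph cs k ↔ cs.length w = k := by
  simp [sph]

open Classical in
/-- Generating function of the elements satisfying `p`. -/
noncomputable def gf (cs : CoxeterSystem M W) (p : W → Prop) : PowerSeries ℤ :=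
  PowerSeries.mk fun k => (((sph cs k).filter p).card : ℤ)

open Classical in
lemma gf_eq (cs : CoxeterSystem M W) (p : W → Prop) :
  gf cs p = PowerSeries.mk fun k => ∑ w ∈ sph cs k, if p w then (1:ℤ) else 0 := by
  ext k; simp [gf]

lemma gf_split (cs : CoxeterSystem M W) (p : W → Prop) :
    gf cs (fun _ => True) = gf cs p + gf cs (fun w => ¬ p w) := by
  ext k
  rw [gf_eq, gf_eq, gf_eq]
  simp only [coeff_mk, map_add, ← Finset.sum_add_distrib]
  refine Finset.sum_congr rfl fun w _ => ?_
  by_cases h : p w <;> simp [h]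

lemma gf_shift (cs : CoxeterSystem M W) (p q : W → Prop) (m : ℕ) (f g : W → W)
    (hf : ∀ w, p w → q (f w) ∧ cs.length (f w) = cs.length w + m ∧ g (f w) = w)
    (hg : ∀ w, q w → p (g w) ∧ f (g w) = w) :
    gf cs q = X ^ m * gf cs p := by
  classical
  ext k
  rw [PowerSeries.coeff_X_pow_mul']
  split_ifs with hk
  · simp only [gf, coeff_mk, Nat.cast_inj]
    refine Finset.card_nbij' g f ?_ ?_ ?_ ?_
    · intro w hw
      simp [mem_sph] at hw ⊢
      have h1 := hg w hw.2
      have h2 := hf _ h1.1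
      rw [h1.2] at h2
      exact ⟨by omega, h1.1⟩
    · intro w hw
      simp [mem_sph] at hw ⊢
      have h2 := hf _ hw.2
      exact ⟨by omega, h2.1⟩
    · intro w hw
      simp [mem_sph] at hw ⊢
      exact (hg w hw.2).2
    · intro w hw
      simp [mem_sph] at hw ⊢
      exact (hf w hw.2).2.2
  · simp only [gf, coeff_mk]
    norm_cast
    rw [Finset.card_eq_zero, Finset.filter_eq_empty_iff]
    intro w hw hq
    rw [mem_sph] at hw
    have h1 := hg w hq
    have h2 := hf _ h1.1
    rw [h1.2] at h2
    omega

lemma gf_desc (cs : CoxeterSystem M W) (i : Fin n) :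
    (1 + X) * gf cs (fun w => cs.IsRightDescent w i) = X * gf cs (fun _ => True) := by
  have h1 := gf_split cs (fun w => cs.IsRightDescent w i)
  have h2 := gf_shift cs (fun w => ¬ cs.IsRightDescent w i) (fun w => cs.IsRightDescent w i) 1
    (fun w => w * cs.simple i) (fun w => w * cs.simple i)
    (fun w hw => ⟨by
      have := cs.isRightDescent_iff_not_isRightDescent_mul (w := w) (i := i)
      tauto, cs.not_isRightDescent_iff.1 hw, by simp⟩)
    (fun w hw => ⟨cs.isRightDescent_iff_not_isRightDescent_mul.1 hw, by simp⟩)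
  rw [h1]
  linear_combination h2

lemma gf_desc2 (H : RootData A cs R) {i j : Fin n} (hij : i ≠ j) :
    gf cs (fun w => cs.IsRightDescent w i ∧ cs.IsRightDescent w j) *
      ((1 + X) * (1 + X + X ^ 2 + X ^ 3)) = X ^ 4 * gf cs (fun _ => True) := by
  have h1 : gf cs (fun _ => True) + gf cs (fun w => cs.IsRightDescent w i ∧ cs.IsRightDescent w j)
      = gf cs (fun w => ¬ cs.IsRightDescent w i ∧ ¬ cs.IsRightDescent w j)
      + gf cs (fun w => cs.IsRightDescent w i) + gf cs (fun w => cs.IsRightDescent w j) := by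
    ext k
    rw [gf_eq, gf_eq, gf_eq, gf_eq, gf_eq]
    simp only [coeff_mk, map_add, ← Finset.sum_add_distrib]
    refine Finset.sum_congr rfl fun w _ => ?_
    by_cases h : cs.IsRightDescent w i <;> by_cases h' : cs.IsRightDescent w j <;> simp [h, h']
  have h2 := gf_shift cs (fun w => ¬ cs.IsRightDescent w i ∧ ¬ cs.IsRightDescent w j)
    (fun w => cs.IsRightDescent w i ∧ cs.IsRightDescent w j) 4
    (fun w => w * cs.simple i * cs.simple j * cs.simple i * cs.simple j)
    (fun w => w * cs.simple j * cs.simple i * cs.simple j * cs.simple i)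
    (fun w hw => ⟨⟨H.d_of_neg (by rw [H.st4' _ hij]; simpa using H.pos' hw.1),
       H.d_of_neg (by rw [H.st4 _ hij]; simpa using H.pos' hw.2)⟩, H.len4 hij hw.1 hw.2, by simp⟩)
    (fun w hw => ⟨⟨H.nd_of_pos (by rw [H.st4 _ hij.symm]; simpa using H.neg' hw.1),
       H.nd_of_pos (by rw [H.st4' _ hij.symm]; simpa using H.neg' hw.2)⟩, by simp⟩)
  have h3 := gf_desc cs i
  have h4 := gf_desc cs j
  have hne : (1 - X : PowerSeries ℤ) ≠ 0 := by
    intro h0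
    have := congrArg (PowerSeries.coeff 0) h0
    simp at this
  apply mul_left_cancel₀ hne
  linear_combination (-(1 + X) * X ^ 4) * h1 + (1 + X) * h2 - X ^ 4 * h3 - X ^ 4 * h4

lemma gf_incl_excl (H : RootData A cs R) :
    2 * gf cs (fun _ => True) - 2 * ∑ i, gf cs (fun w => cs.IsRightDescent w i)
      + ∑ i, ∑ j ∈ Finset.univ.erase i,
        gf cs (fun w => cs.IsRightDescent w i ∧ cs.IsRightDescent w j) = 2 := by
  classical
  have key : ∀ w : W, 2 * (1:ℤ) - 2 * ∑ i, (if cs.IsRightDescent w i then (1:ℤ) else 0)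
      + ∑ i, ∑ j ∈ Finset.univ.erase i,
        (if cs.IsRightDescent w i ∧ cs.IsRightDescent w j then (1:ℤ) else 0)
      = if w = 1 then 2 else 0 := by
    intro w
    set D : Finset (Fin n) := Finset.univ.filter (fun i => cs.IsRightDescent w i) with hD
    have e1 : ∑ i, (if cs.IsRightDescent w i then (1:ℤ) else 0) = D.card := by simp [hD]
    have e2 : ∑ i, ∑ j ∈ Finset.univ.erase i,
        (if cs.IsRightDescent w i ∧ cs.IsRightDescent w j then (1:ℤ) else 0)
        = D.card * (D.card - 1) := by
      have : ∀ i, ∑ j ∈ Finset.univ.erase i,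
        (if cs.IsRightDescent w i ∧ cs.IsRightDescent w j then (1:ℤ) else 0)
        = if cs.IsRightDescent w i then ((D.card : ℤ) - 1) else 0 := by
        intro i
        by_cases hi : cs.IsRightDescent w i
        · have := Finset.add_sum_erase Finset.univ
            (fun j => if cs.IsRightDescent w j then (1:ℤ) else 0) (Finset.mem_univ i)
          rw [e1] at this
          simp only [hi, true_and, if_true] at this ⊢
          linarith
        · simp [hi]
      simp only [this]
      rw [← Finset.sum_filter, Finset.sum_const, nsmul_eq_mul]
    rw [e1, e2]
    have hc : D.card ≤ 2 := by
      by_contra hc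
      obtain ⟨a, b, c, ha, hb, hc, hab, hac, hbc⟩ := Finset.two_lt_card_iff.1 (not_le.1 hc)
      simp [hD] at ha hb hc
      exact H.no_three hab hac hbc w ha hb hc
    by_cases hw : w = 1
    · subst hw
      have : D.card = 0 := by
        simp [hD, cs.not_isRightDescent_one]
      simp [this]
    · obtain ⟨t, ht⟩ := cs.exists_rightDescent_of_ne_one hw
      have : 0 < D.card := Finset.card_pos.2 ⟨t, by simp [hD, ht]⟩
      simp only [hw, if_false]
      interval_cases D.card <;> simp
  ext k
  have h2 : (2 : PowerSeries ℤ) = PowerSeries.C 2 := by simp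
  simp only [gf_eq]
  rw [h2]
  simp only [map_add, map_sub, map_sum, PowerSeries.coeff_C_mul, coeff_mk, if_true]
  have : ∑ w ∈ sph cs k, (if w = 1 then (2:ℤ) else 0) = PowerSeries.coeff k (PowerSeries.C (2:ℤ)) := by
    rw [PowerSeries.coeff_C, Finset.sum_ite_eq']
    simp only [mem_sph, cs.length_one, eq_comm]
  rw [← this, ← Finset.sum_congr rfl fun w _ => key w]
  rw [Finset.sum_add_distrib, Finset.sum_sub_distrib, ← Finset.mul_sum, ← Finset.mul_sum,
    Finset.sum_comm]
  congr 1
  rw [Finset.sum_comm]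
  refine Finset.sum_congr rfl fun i _ => ?_
  rw [Finset.sum_comm]
  refine Finset.sum_congr rfl fun _ _ => Finset.sum_congr rfl fun _ _ => ?_
  congr

lemma gf_main (H : RootData A cs R) :
    (((n : PowerSeries ℤ) - 1) * ((n : PowerSeries ℤ) - 2) * X ^ 4
        - 2 * ((n : PowerSeries ℤ) - 2) * (X ^ 3 + X ^ 2 + X) + 2) * gf cs (fun _ => True)
      = 2 * ((1 + X) * (1 + X + X ^ 2 + X ^ 3)) := by
  have h1 : (∑ i, gf cs (fun w => cs.IsRightDescent w i)) *
      ((1 + X) * (1 + X + X ^ 2 + X ^ 3)) = (n : PowerSeries ℤ) * (X * gf cs (fun _ => True) * (1 + X + X ^ 2 + X ^ 3)) := by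
    rw [Finset.sum_mul, Finset.sum_congr rfl (g := fun _ =>
      X * gf cs (fun _ => True) * (1 + X + X ^ 2 + X ^ 3))]
    · simp
    · intro i _
      rw [← gf_desc cs i]; ring
  have h2 : (∑ i, ∑ j ∈ Finset.univ.erase i,
        gf cs (fun w => cs.IsRightDescent w i ∧ cs.IsRightDescent w j)) *
      ((1 + X) * (1 + X + X ^ 2 + X ^ 3)) = (n : PowerSeries ℤ) * (((n : PowerSeries ℤ) - 1) * (X ^ 4 * gf cs (fun _ => True))) := by
    rw [Finset.sum_mul, Finset.sum_congr rfl (g := fun _ =>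
      ((n : PowerSeries ℤ) - 1) * (X ^ 4 * gf cs (fun _ => True)))]
    · simp
    · intro i _
      rw [Finset.sum_mul, Finset.sum_congr rfl (g := fun _ => X ^ 4 * gf cs (fun _ => True))]
      · have hn : 1 ≤ n := by have := i.2; omega
        simp [Finset.card_erase_of_mem, Nat.cast_sub hn]
      · intro j hj
        exact gf_desc2 H (Finset.ne_of_mem_erase hj).symm
  have h := gf_incl_excl H
  linear_combination ((1 + X) * (1 + X + X ^ 2 + X ^ 3)) * h + 2 * h1 - h2

end

/-- for an `n × n` generalized Cartan matrix (`n ≥ 2`) with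
`aᵢⱼ·aⱼᵢ = 2` for all `i ≠ j`,
`(((n−1)(n−2)/2)·t⁴ − (n−2)·(t³+t²+t) + 1)·P(A) = (1+t)(1+t+t²+t³)`. -/
theorem poincare_all_products_two {n : ℕ} (hn : 2 ≤ n)
    (A : Matrix (Fin n) (Fin n) ℤ) (hA : IsGCM A)
    (h : ∀ i j, i ≠ j → A i j * A j i = 2) :
    ((((n - 1) * (n - 2) / 2 : ℕ) : PowerSeries ℤ) * X ^ 4
        - ((n - 2 : ℕ) : PowerSeries ℤ) * (X ^ 3 + X ^ 2 + X) + 1) * coxPoincare (gcmCoxeter A)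
      = (1 + X) * (1 + X + X ^ 2 + X ^ 3) := by
  have hM : ∀ i j, i ≠ j → gcmCoxeter A i j = 4 := by
    intro i j hij
    change (if i = j then 1 else gcmEntry (A i j * A j i)) = 4
    rw [if_neg hij, h i j hij]
    rfl
  let cs := (gcmCoxeter A).toCoxeterSystem
  have hl := srefl_liftable A hA.diag h (gcmCoxeter A) hM
  let ρ := cs.lift ⟨srefl A, hl⟩
  have hρ : ∀ i, ρ (cs.simple i) = srefl A i := fun i => cs.lift_apply_simple hl i
  have H : RootData A cs (fun w i => ρ w (Pi.single i 1)) := by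
    refine ⟨hA.nonpos, hA.diag, h, hM, ?_, ?_, ?_⟩
    · intro i; simp
    · intro w i j
      simp only [map_mul, Module.End.mul_apply, hρ, srefl_apply, map_sub, map_smul]
      simp [Pi.single_apply]
    · intro w i h0
      have h1 : ρ (w⁻¹ * w) (Pi.single i 1) = 0 := by
        rw [map_mul, Module.End.mul_apply]
        rw [h0, map_zero]
      rw [inv_mul_cancel, map_one, Module.End.one_apply] at h1
      have := congrFun h1 i
      simp at this
  have hP : coxPoincare (gcmCoxeter A) = gf cs (fun _ => True) := by
    ext k
    simp only [coxPoincare, gf, coeff_mk, Nat.cast_inj, Finset.filter_true]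
    exact Nat.subtype_card _ (fun w => mem_sph cs k w)
  have hm := gf_main H
  rw [hP]
  obtain ⟨m, rfl⟩ : ∃ m, n = m + 2 := ⟨n - 2, by omega⟩
  have hd : (m + 2 - 1) * (m + 2 - 2) / 2 * 2 = (m + 1) * m := by
    simp only [Nat.add_sub_cancel, show m + 2 - 1 = m + 1 by omega]
    refine Nat.div_mul_cancel ?_
    rw [mul_comm]
    exact (Nat.even_mul_succ_self m).two_dvd
  have hd' := congrArg (Nat.cast : ℕ → PowerSeries ℤ) hd
  rw [Nat.cast_mul] at hd'
  push_cast at hd' hm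
  have h20 : (2 : PowerSeries ℤ) ≠ 0 := by
    intro h0
    have := congrArg (PowerSeries.coeff 0) h0
    have h2 : (2 : PowerSeries ℤ) = PowerSeries.C 2 := by simp
    rw [h2, PowerSeries.coeff_C, if_pos rfl, map_zero] at this
    exact absurd this (by norm_num)
  apply mul_left_cancel₀ h20
  simp only [Nat.add_sub_cancel, show m + 2 - 1 = m + 1 by omega] at hd' ⊢
  linear_combination hm + X ^ 4 * gf cs (fun _ => True) * hd'
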